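/- Let G = (V, m) be a finite connected loopless multigraph (weightless), let d be an effective divisor on G, and let u be a vertex with d(u) = ℓ_G(d). Let G′ = (V, m′) be a saturation of G with respect to u and d, and let M := Σ_{v∈V} (m′(u,v) − m(u,v)) be the number of added edges. Then r_G(d) ≤ ℓ_G(d) + M. -/

import Mathlib

open Finset

variable {V : Type*} [Fintype V] [DecidableEq V]

/-- Intersection number `v · A`. -/
def dot (m : V → V → ℕ) (v : V) (A : Finset V) : ℤ := ∑ w ∈ A, (m v w : ℤ)

/-- The principal divisor `t_Z` associated to a set of vertices `Z`. -/
def tdiv (m : V → V → ℕ) (Z : Finset V) : V → ℤ :=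
  fun v => if v ∈ Z then -(dot m v Zᶜ) else dot m v Z

/-- The subgroup of principal divisors of the multigraph `(V, m)`. -/
def Prin (m : V → V → ℕ) : AddSubgroup (V → ℤ) :=
  AddSubgroup.closure (Set.range (tdiv m))

/-- A divisor is effective if all its values are nonnegative. -/
def Effective (d : V → ℤ) : Prop := ∀ v, 0 ≤ d v

/-- The degree of a divisor. -/
def deg (d : V → ℤ) : ℤ := ∑ v, d v

/-- `d` is linearly equivalent to an effective divisor. -/
def EquivEff (m : V → V → ℕ) (d : V → ℤ) : Prop :=
  ∃ e : V → ℤ, Effective e ∧ d - e ∈ Prin m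

/-- The Baker–Norine combinatorial rank of a divisor on a weightless loopless
multigraph: `-1` if `d` is not equivalent to an effective divisor, and otherwise
the largest `k ≥ 0` such that for every effective divisor `e` of degree `k`,
`d - e` is equivalent to an effective divisor. -/
noncomputable def bnrank (m : V → V → ℕ) (d : V → ℤ) : ℤ :=
  sSup ({-1} ∪ {k : ℤ | 0 ≤ k ∧
    ∀ e : V → ℤ, Effective e → deg e = k → EquivEff m (d - e)})

/-- Connectedness: any two vertices are joined by a path of edges of
positive multiplicity. -/
def Conn (m : V → V → ℕ) : Prop :=
  ∀ v w : V, Relation.ReflTransGen (fun a b => 0 < m a b) v w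

/-- `d` is `u`-reduced. -/
def Reduced (m : V → V → ℕ) (u : V) (d : V → ℤ) : Prop :=
  (∀ v, v ≠ u → 0 ≤ d v) ∧
  ∀ A : Finset V, A.Nonempty → u ∉ A → ∃ v ∈ A, d v < dot m v Aᶜ

open Classical in
/-- `ℓ_G(d)` for a weightless graph: the minimum value of `d` if `d` is
effective, and `-1` otherwise. -/
noncomputable def ell [Nonempty V] (d : V → ℤ) : ℤ :=
  if Effective d then Finset.univ.inf' Finset.univ_nonempty d else -1

/-- Edge multiplicities of the weightless loopless graph `Ĝ` associated to the
weighted graph `(V, m, g)`: for each `v` we add `g v` new vertices, each joined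
to `v` by two edges. -/
def hatm (m : V → V → ℕ) (g : V → ℕ) :
    (V ⊕ Σ v : V, Fin (g v)) → (V ⊕ Σ v : V, Fin (g v)) → ℕ
  | Sum.inl v, Sum.inl w => m v w
  | Sum.inl v, Sum.inr z => if z.1 = v then 2 else 0
  | Sum.inr z, Sum.inl w => if z.1 = w then 2 else 0
  | Sum.inr _, Sum.inr _ => 0

/-- Extension of a divisor on `G` to `Ĝ` by zero on the new vertices. -/
def hatd (g : V → ℕ) (d : V → ℤ) : (V ⊕ Σ v : V, Fin (g v)) → ℤ :=
  Sum.elim d fun _ => 0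

/-- The combinatorial rank of a divisor on the weighted graph `(V, m, g)`,
defined as the Baker–Norine rank of its extension to `Ĝ`. -/
noncomputable def wrank (m : V → V → ℕ) (g : V → ℕ) (d : V → ℤ) : ℤ :=
  bnrank (hatm m g) (hatd g d)

/-- `e^deg`, for an effective divisor `e` on a weighted graph. -/
def edeg (g : V → ℕ) (e : V → ℤ) : V → ℤ :=
  fun v => e v + min (e v) (g v : ℤ)

/-- `d_rk(v) = max (d v - g v) ⌊d v / 2⌋` (note `/` is floor division since
the divisor `2` is positive). -/
def drk (g : V → ℕ) (d : V → ℤ) : V → ℤ :=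
  fun v => max (d v - (g v : ℤ)) (d v / 2)

open Classical in
/-- `ℓ_G(d)` for a weighted graph. -/
noncomputable def ellw [Nonempty V] (g : V → ℕ) (d : V → ℤ) : ℤ :=
  if Effective d then Finset.univ.inf' Finset.univ_nonempty (drk g d) else -1

/-- Every principal divisor is the Laplacian of an integer-valued function. -/
theorem exists_laplacian_of_mem_Prin {V : Type*} [Fintype V] [DecidableEq V]
    {m : V → V → ℕ} {p : V → ℤ} (hp : p ∈ Prin m) :
    ∃ x : V → ℤ, ∀ v, p v = ∑ w, (m v w : ℤ) * (x w - x v) := by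
  induction hp using AddSubgroup.closure_induction with
  | mem p hp =>
    obtain ⟨Z, rfl⟩ := hp
    refine ⟨fun v => if v ∈ Z then 1 else 0, fun v => ?_⟩
    by_cases hv : v ∈ Z
    · rw [tdiv, if_pos hv, dot, ← Finset.sum_neg_distrib, ← Finset.sum_subset (subset_univ Zᶜ)]
      · exact Finset.sum_congr rfl fun w hw => by simp [hv, mem_compl.1 hw]
      · intro w _ hw
        simp [hv, show w ∈ Z by simpa using hw]
    · rw [tdiv, if_neg hv, dot, ← Finset.sum_subset (subset_univ Z)]
      · exact Finset.sum_congr rfl fun w hw => by simp [hv, hw]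
      · intro w _ hw
        simp [hv, hw]
  | zero => exact ⟨0, fun v => by simp⟩
  | add p q _ _ hp hq =>
    obtain ⟨x, hx⟩ := hp
    obtain ⟨y, hy⟩ := hq
    refine ⟨x + y, fun v => ?_⟩
    rw [Pi.add_apply, hx, hy, ← Finset.sum_add_distrib]
    exact Finset.sum_congr rfl fun w _ => by simp only [Pi.add_apply]; ring
  | neg p _ hp =>
    obtain ⟨x, hx⟩ := hp
    refine ⟨-x, fun v => ?_⟩
    rw [Pi.neg_apply, hx, ← Finset.sum_neg_distrib]
    exact Finset.sum_congr rfl fun w _ => by simp only [Pi.neg_apply]; ring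

/-- At a minimum of `x`, the Laplacian of `x` is at least the number of edges leaving the set
of minima. -/
theorem dot_le_laplacian {V : Type*} [Fintype V] [DecidableEq V] (m : V → V → ℕ)
    {x : V → ℤ} {v : V} (hv : ∀ w, x v ≤ x w) :
    dot m v (univ.filter fun w => ∀ z, x w ≤ x z)ᶜ ≤ ∑ w, (m v w : ℤ) * (x w - x v) := by
  refine le_trans (Finset.sum_le_sum fun w hw => ?_)
    (Finset.sum_le_sum_of_subset_of_nonneg (subset_univ _) fun w _ _ =>
      mul_nonneg (Int.natCast_nonneg _) (sub_nonneg.2 (hv w)))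
  simp only [mem_compl, mem_filter, mem_univ, true_and, not_forall, not_le] at hw
  obtain ⟨z, hz⟩ := hw
  have := hv z
  exact le_mul_of_one_le_right (Int.natCast_nonneg _) (by omega)

/-- Adding edges at `u` changes the number of edges from `v ≠ u` to a set containing `u` by the
number of edges added between `u` and `v`. -/
theorem dot_saturation {V : Type*} [DecidableEq V] {m m' : V → V → ℕ} {u v : V}
    (hsymm : ∀ v w, m v w = m w v) (hsymm' : ∀ v w, m' v w = m' w v)
    (hsame : ∀ v w, u ≠ v → u ≠ w → m' v w = m v w) (hv : u ≠ v) {B : Finset V} (hB : u ∈ B) :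
    dot m' v B = dot m v B + ((m' u v : ℤ) - m u v) := by
  have h : ∑ w ∈ B.erase u, (m' v w : ℤ) = ∑ w ∈ B.erase u, (m v w : ℤ) :=
    Finset.sum_congr rfl fun w hw => by rw [hsame v w hv (ne_of_mem_erase hw).symm]
  rw [dot, dot, ← Finset.add_sum_erase _ _ hB, ← Finset.add_sum_erase _ _ hB, h,
    hsymm' v u, hsymm v u]
  ring

/-- A divisor `f` which is negative at `u`, and at every other vertex is at most `d` minus the
number of edges added between that vertex and `u`, is not equivalent to an effective divisor,
if `d` is `u`-reduced on the saturation. -/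
theorem not_equivEff_of_reduced {V : Type*} [Fintype V] [DecidableEq V] {m m' : V → V → ℕ}
    {u : V} {d f : V → ℤ} (hsymm : ∀ v w, m v w = m w v) (hsymm' : ∀ v w, m' v w = m' w v)
    (hsame : ∀ v w, u ≠ v → u ≠ w → m' v w = m v w) (hred : Reduced m' u d)
    (hfu : f u < 0) (hf : ∀ v, u ≠ v → f v ≤ d v - ((m' u v : ℤ) - m u v)) :
    ¬ EquivEff m f := by
  rintro ⟨g, hg, hp⟩
  obtain ⟨x, hx⟩ := exists_laplacian_of_mem_Prin hp
  simp only [Pi.sub_apply] at hx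
  set A : Finset V := univ.filter fun w => ∀ z, x w ≤ x z with hA
  have hmin : ∀ v ∈ A, dot m v Aᶜ ≤ f v := fun v hv => by
    have h := dot_le_laplacian m (mem_filter.1 hv).2
    rw [← hA, ← hx v] at h
    linarith [hg v]
  by_cases huA : u ∈ A
  · have h0 : 0 ≤ dot m u Aᶜ := Finset.sum_nonneg fun _ _ => Int.natCast_nonneg _
    linarith [hmin u huA]
  · have hne : A.Nonempty := by
      obtain ⟨v, -, hv⟩ := Finset.exists_min_image univ x ⟨u, mem_univ u⟩
      exact ⟨v, mem_filter.2 ⟨mem_univ v, fun z => hv z (mem_univ z)⟩⟩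
    obtain ⟨v, hv, hlt⟩ := hred.2 A hne huA
    have huv : u ≠ v := fun h => huA (h ▸ hv)
    rw [dot_saturation hsymm hsymm' hsame huv (mem_compl.2 huA)] at hlt
    linarith [hmin v hv, hf v huv]

/-- If `d` is an effective divisor with `d u = ℓ_G(d)`, and `G'` is a
saturation of `G` with respect to `u` and `d` obtained by adding `M` edges at
`u`, then `r_G(d) ≤ ℓ_G(d) + M`. -/
theorem stmt8 {V : Type*} [Fintype V] [DecidableEq V] [Nonempty V]
    (m : V → V → ℕ) (hsymm : ∀ v w, m v w = m w v) (hloop : ∀ v, m v v = 0)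
    (hconn : Conn m) (d : V → ℤ) (hd : Effective d) (u : V) (hu : d u = ell d)
    (m' : V → V → ℕ) (hsymm' : ∀ v w, m' v w = m' w v) (hloop' : ∀ v, m' v v = 0)
    (hle : ∀ v w, m v w ≤ m' v w)
    (hsame : ∀ v w, u ≠ v → u ≠ w → m' v w = m v w)
    (hred : Reduced m' u d) :
    bnrank m d ≤ ell d + ∑ v : V, ((m' u v : ℤ) - (m u v : ℤ)) := by
  have hc : ∀ v, (0 : ℤ) ≤ (m' u v : ℤ) - m u v := fun v =>
    sub_nonneg.2 (Int.ofNat_le.2 (hle u v))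
  have hM : 0 ≤ ∑ v, ((m' u v : ℤ) - m u v) := Finset.sum_nonneg fun v _ => hc v
  rw [← hu]
  have hdu := hd u
  refine csSup_le ⟨-1, Or.inl rfl⟩ ?_
  rintro k (rfl | ⟨-, hk⟩)
  · linarith
  by_contra! hlt
  have ha : d u < k - ∑ v, ((m' u v : ℤ) - m u v) := by linarith
  refine not_equivEff_of_reduced hsymm hsymm' hsame hred ?_ ?_
    (hk (fun v => ((m' u v : ℤ) - m u v) +
      if v = u then k - ∑ v, ((m' u v : ℤ) - m u v) else 0) (fun v => ?_) ?_)
  · simpa [hloop, hloop'] using ha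
  · intro v hv
    simp [hv.symm]
  · refine add_nonneg (hc v) ?_
    split_ifs
    · linarith
    · exact le_rfl
  · rw [deg, Finset.sum_add_distrib, Finset.sum_ite_eq' univ u, if_pos (mem_univ u)]
    ring
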